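/- Let n ≥ 1 and let K be a compact topological space. Let τ : K → ℂ be continuous with Im τ(k) > 0 for all k ∈ K, and let q₁, …, qₙ : K → ℂ be continuous functions such that qᵢ(k) − qⱼ(k) ∉ ℤ + τ(k)ℤ for every k ∈ K and all i ≠ j. For k ∈ K set Q(k) = diag(q₁(k), …, qₙ(k)), P_x(k) = π(Im τ(k))⁻¹(Q(k) − Q(k)*), P_y(k) = −iπ(Im τ(k))⁻¹(Q(k) + Q(k)*), and let F_k = {x + y τ(k) : x, y ∈ [0,1]} ⊂ ℂ. Then there exists a constant C > 0 such that for every k ∈ K and every smooth map η : ℂ → Mₙ(ℂ) satisfying η(z + 1) = η(z) = η(z + τ(k)) for all z and such that ∫_{F_k} tr(η(z) D*) dz = 0 for every constant diagonal matrix D ∈ Mₙ(ℂ), one has ∫_{F_k} ( ‖∂η/∂x + [P_x(k), η]‖² + ‖∂η/∂y + [P_y(k), η]‖² ) dz ≥ C ∫_{F_k} ‖η‖² dz. -/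

import Mathlib

open Matrix
open MeasureTheory

def USq : Set (ℝ × ℝ) := Set.Icc (0 : ℝ) 1 ×ˢ Set.Icc (0 : ℝ) 1

lemma USq_compact : IsCompact USq := isCompact_Icc.prod isCompact_Icc

lemma USq_int {E : Type*} [NormedAddCommGroup E] {f : ℝ × ℝ → E} (hf : Continuous f) :
    IntegrableOn f USq := hf.continuousOn.integrableOn_compact USq_compact

lemma USq_const (c : ℝ) : ∫ _ in USq, c = c := by
  have : (volume : Measure (ℝ × ℝ)).real USq = 1 := by
    rw [USq, Measure.real, Measure.volume_eq_prod, Measure.prod_prod]; simp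
  rw [setIntegral_const, this, one_smul]

lemma USq_iter {f : ℝ × ℝ → ℝ} (hf : Continuous f) :
    ∫ p in USq, f p = ∫ s in (0:ℝ)..1, ∫ t in (0:ℝ)..1, f (s, t) := by
  have h := USq_int hf
  rw [USq, Measure.volume_eq_prod] at *
  rw [setIntegral_prod _ h]
  rw [integral_Icc_eq_integral_Ioc, intervalIntegral.integral_of_le zero_le_one]
  simp_rw [integral_Icc_eq_integral_Ioc, intervalIntegral.integral_of_le zero_le_one]

lemma USq_swap (f : ℝ × ℝ → ℝ) :
    ∫ p in USq, f p = ∫ p in USq, f p.swap := by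
  rw [USq, Measure.volume_eq_prod]
  exact (setIntegral_prod_swap (μ := volume) (ν := volume) _ _ f).symm

lemma USq_avg2 {f : ℝ × ℝ → ℝ} (hf : Continuous f) :
    Continuous (fun s : ℝ => ∫ t in (0:ℝ)..1, f (s, t)) ∧
    ∫ p in USq, (∫ t in (0:ℝ)..1, f (p.1, t)) = ∫ p in USq, f p := by
  have hc : Continuous (fun s : ℝ => ∫ t in (0:ℝ)..1, f (s, t)) :=
    intervalIntegral.continuous_parametric_intervalIntegral_of_continuous' (by simpa [Function.uncurry_def] using hf) _ _
  refine ⟨hc, ?_⟩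
  rw [USq_iter hf, USq_iter (f := fun p => ∫ t in (0:ℝ)..1, f (p.1, t)) (hc.comp continuous_fst)]
  simp

lemma USq_avg1 {f : ℝ × ℝ → ℝ} (hf : Continuous f) :
    Continuous (fun t : ℝ => ∫ s in (0:ℝ)..1, f (s, t)) ∧
    ∫ p in USq, (∫ s in (0:ℝ)..1, f (s, p.2)) = ∫ p in USq, f p := by
  have h := USq_avg2 (f := fun p => f p.swap) (by fun_prop)
  refine ⟨h.1, ?_⟩
  rw [USq_swap f, ← h.2, USq_swap]
  rfl

lemma cs_interval {f : ℝ → ℝ} (hf : Continuous f) (s : ℝ) :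
    (∫ x in s..(s+1), f x) ^ 2 ≤ ∫ x in s..(s+1), f x ^ 2 := by
  set m := ∫ x in s..(s+1), f x with hm
  have h0 : 0 ≤ ∫ x in s..(s+1), (f x - m) ^ 2 :=
    intervalIntegral.integral_nonneg (by linarith) (fun _ _ => sq_nonneg _)
  have : ∫ x in s..(s+1), (f x - m) ^ 2 = (∫ x in s..(s+1), f x ^ 2) - m ^ 2 := by
    have : ∀ x, (f x - m)^2 = f x ^ 2 - ((2 * m) * f x - m ^ 2) := by intro x; ring
    simp_rw [this]
    rw [intervalIntegral.integral_sub, intervalIntegral.integral_sub, intervalIntegral.integral_const_mul, ← hm]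
    · simp; ring
    all_goals exact Continuous.intervalIntegrable (by fun_prop) _ _
  linarith

lemma twisted1 {h h' : ℝ → ℂ} (hc : Continuous h') (hd : ∀ s, HasDerivAt h (h' s) s)
    (hp : ∀ s, h (s + 1) = h s) (α : ℝ) (s : ℝ) :
    ‖Complex.exp (α * Complex.I) - 1‖ ^ 2 * ‖h s‖ ^ 2 ≤
      ∫ x in (0:ℝ)..1, ‖h' x + α * Complex.I * h x‖ ^ 2 := by
  have hhc : Continuous h := continuous_iff_continuousAt.2 fun s => (hd s).continuousAt
  set w : ℝ → ℂ := fun s => Complex.exp (α * Complex.I * s) * h s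
  set w' : ℝ → ℂ := fun s => Complex.exp (α * Complex.I * s) * (h' s + α * Complex.I * h s)
  have hw : ∀ s, HasDerivAt w (w' s) s := by
    intro s
    have h1 : HasDerivAt (fun s : ℝ => Complex.exp (α * Complex.I * s))
        (Complex.exp (α * Complex.I * s) * (α * Complex.I * 1)) s :=
      ((Complex.ofRealCLM.hasDerivAt (x := s)).const_mul (α * Complex.I)).cexp
    refine (h1.mul (hd s)).congr_deriv ?_
    show _ = Complex.exp (α * Complex.I * s) * (h' s + α * Complex.I * h s)
    ring
  have hwc : Continuous w' := by fun_prop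
  have hnorm : ∀ x : ℝ, ‖Complex.exp (α * Complex.I * x)‖ = 1 := by
    intro x
    have := Complex.norm_exp_ofReal_mul_I (α * x)
    rw [← this]; push_cast; ring_nf
  have hft : ∫ x in s..(s+1), w' x = w (s+1) - w s :=
    intervalIntegral.integral_eq_sub_of_hasDerivAt (fun x _ => hw x) (hwc.intervalIntegrable _ _)
  have e : w (s+1) - w s = (Complex.exp (α * Complex.I) - 1) * (Complex.exp (α * Complex.I * s) * h s) := by
    simp only [w, hp]
    push_cast
    rw [mul_add, Complex.exp_add, mul_one]; ring
  have hn : ‖w (s+1) - w s‖ = ‖Complex.exp (α * Complex.I) - 1‖ * ‖h s‖ := by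
    rw [e, norm_mul, norm_mul, hnorm, one_mul]
  have hn' : ∀ x, ‖w' x‖ = ‖h' x + α * Complex.I * h x‖ := by
    intro x; simp only [w', norm_mul, hnorm, one_mul]
  have hp' : ∀ s, h' (s+1) = h' s := by
    intro s
    have h1 : HasDerivAt (fun x => h (x + 1)) (h' (s+1)) s := (hd (s+1)).comp_add_const s 1
    simp_rw [hp] at h1
    exact h1.unique (hd s)
  have hper : Function.Periodic (fun x => ‖w' x‖ ^ 2) 1 := by
    intro x; simp only [hn', hp, hp']
  calc _ = ‖w (s+1) - w s‖ ^ 2 := by rw [hn]; ring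
    _ ≤ (∫ x in s..(s+1), ‖w' x‖) ^ 2 := by
      rw [← hft]; gcongr
      exact intervalIntegral.norm_integral_le_integral_norm (by linarith)
    _ ≤ ∫ x in s..(s+1), ‖w' x‖ ^ 2 := cs_interval (by fun_prop) s
    _ = ∫ x in (0:ℝ)..(0+1), ‖w' x‖ ^ 2 := hper.intervalIntegral_add_eq s 0
    _ = _ := by simp only [hn', zero_add]

lemma osc1 {h h' : ℝ → ℂ} (hc : Continuous h') (hd : ∀ s, HasDerivAt h (h' s) s)
    {s r : ℝ} (hs : s ∈ Set.Icc (0:ℝ) 1) (hr : r ∈ Set.Icc (0:ℝ) 1) :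
    ‖h s - h r‖ ^ 2 ≤ ∫ x in (0:ℝ)..1, ‖h' x‖ ^ 2 := by
  have key : ∀ s r : ℝ, s ∈ Set.Icc (0:ℝ) 1 → r ∈ Set.Icc (0:ℝ) 1 → r ≤ s → 
      ‖h s - h r‖ ^ 2 ≤ ∫ x in (0:ℝ)..1, ‖h' x‖ ^ 2 := by
    intro s r hs hr hrs
    have hft : ∫ x in r..s, h' x = h s - h r :=
      intervalIntegral.integral_eq_sub_of_hasDerivAt (fun x _ => hd x) (hc.intervalIntegrable _ _)
    have h1 : ‖h s - h r‖ ≤ ∫ x in (0:ℝ)..(0+1), ‖h' x‖ := by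
      rw [← hft, zero_add]
      refine (intervalIntegral.norm_integral_le_integral_norm hrs).trans ?_
      exact intervalIntegral.integral_mono_interval hr.1 hrs hs.2
        (Filter.Eventually.of_forall fun _ => norm_nonneg _) (hc.norm.intervalIntegrable _ _)
    calc _ ≤ (∫ x in (0:ℝ)..(0+1), ‖h' x‖) ^ 2 := by gcongr
      _ ≤ ∫ x in (0:ℝ)..(0+1), ‖h' x‖ ^ 2 := cs_interval (by fun_prop) 0
      _ = _ := by simp only [zero_add]
  rcases le_total r s with h1 | h1
  · exact key s r hs hr h1
  · rw [norm_sub_rev]; exact key r s hr hs h1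

lemma twisted2 {g gs gt : ℝ × ℝ → ℂ} (hg : Continuous g) (hgs : Continuous gs) (hgt : Continuous gt)
    (hds : ∀ s t, HasDerivAt (fun x => g (x, t)) (gs (s, t)) s)
    (hdt : ∀ s t, HasDerivAt (fun x => g (s, x)) (gt (s, t)) t)
    (hps : ∀ s t, g (s + 1, t) = g (s, t)) (hpt : ∀ s t, g (s, t + 1) = g (s, t)) (α β : ℝ) :
    (‖Complex.exp (α * Complex.I) - 1‖ ^ 2 + ‖Complex.exp (β * Complex.I) - 1‖ ^ 2) *
        ∫ p in USq, ‖g p‖ ^ 2 ≤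
      ∫ p in USq, (‖gs p + α * Complex.I * g p‖ ^ 2 + ‖gt p + β * Complex.I * g p‖ ^ 2) := by
  have c1 : Continuous fun p => ‖gs p + α * Complex.I * g p‖ ^ 2 := by fun_prop
  have c2 : Continuous fun p => ‖gt p + β * Complex.I * g p‖ ^ 2 := by fun_prop
  obtain ⟨a1, b1⟩ := USq_avg1 c1
  obtain ⟨a2, b2⟩ := USq_avg2 c2
  replace a1 := a1.comp (continuous_snd (X := ℝ) (Y := ℝ))
  replace a2 := a2.comp (continuous_fst (X := ℝ) (Y := ℝ))
  simp only [Function.comp_def] at a1 a2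
  rw [integral_add (USq_int c1) (USq_int c2), add_mul, ← b1, ← b2]
  rw [← integral_const_mul, ← integral_const_mul]
  refine add_le_add (integral_mono (USq_int (by fun_prop)) (USq_int a1) fun p => ?_)
    (integral_mono (USq_int (by fun_prop)) (USq_int a2) fun p => ?_)
  · exact twisted1 (h := fun x => g (x, p.2)) (h' := fun x => gs (x, p.2)) (by fun_prop)
      (fun s => hds s _) (fun s => hps s _) α p.1
  · exact twisted1 (h := fun x => g (p.1, x)) (h' := fun x => gt (p.1, x)) (by fun_prop)
      (fun s => hdt _ s) (fun s => hpt _ s) β p.2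

lemma meanzero2 {g gs gt : ℝ × ℝ → ℂ} (hg : Continuous g) (hgs : Continuous gs) (hgt : Continuous gt)
    (hds : ∀ s t, HasDerivAt (fun x => g (x, t)) (gs (s, t)) s)
    (hdt : ∀ s t, HasDerivAt (fun x => g (s, x)) (gt (s, t)) t)
    (h0 : ∫ p in USq, g p = 0) :
    ∫ p in USq, ‖g p‖ ^ 2 ≤ ∫ p in USq, (‖gs p‖ ^ 2 + ‖gt p‖ ^ 2) := by
  have c1 : Continuous fun p => ‖gs p‖ ^ 2 := by fun_prop
  have c2 : Continuous fun p => ‖gt p‖ ^ 2 := by fun_prop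
  obtain ⟨a1, b1⟩ := USq_avg1 c1
  obtain ⟨a2, b2⟩ := USq_avg2 c2
  replace a1 := a1.comp (continuous_snd (X := ℝ) (Y := ℝ))
  replace a2 := a2.comp (continuous_fst (X := ℝ) (Y := ℝ))
  simp only [Function.comp_def] at a1 a2
  have hms : MeasurableSet USq := USq_compact.measurableSet
  have hvar : ∀ c : ℂ, ∫ p in USq, ‖g p - c‖ ^ 2 = (∫ p in USq, ‖g p‖ ^ 2) + ‖c‖ ^ 2 := by
    intro c
    have e : ∀ p, ‖g p - c‖ ^ 2 = (‖g p‖ ^ 2 + ‖c‖ ^ 2) - 2 * inner ℝ c (g p) := by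
      intro p; rw [norm_sub_sq_real, real_inner_comm]; ring
    simp_rw [e]
    rw [integral_sub, integral_add, USq_const, integral_const_mul, integral_inner, h0]
    · simp
    · exact USq_int hg
    all_goals exact USq_int (by fun_prop)
  have hstep : ∀ p' ∈ USq, (∫ p in USq, ‖g p‖ ^ 2) + ‖g p'‖ ^ 2 ≤
      2 * (∫ p in USq, ‖gs p‖ ^ 2) + 2 * ∫ t in (0:ℝ)..1, ‖gt (p'.1, t)‖ ^ 2 := by
    intro p' hp'
    rw [← hvar]
    have : ∫ p in USq, ‖g p - g p'‖ ^ 2 ≤ ∫ p in USq,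
        (2 * (∫ s in (0:ℝ)..1, ‖gs (s, p.2)‖ ^ 2) + 2 * ∫ t in (0:ℝ)..1, ‖gt (p'.1, t)‖ ^ 2) := by
      refine setIntegral_mono_on (USq_int (by fun_prop)) (USq_int ?_) hms ?_
      · exact (a1.const_mul 2 |>.add continuous_const)
      · intro p hp
        have o1 := osc1 (h := fun x => g (x, p.2)) (h' := fun x => gs (x, p.2)) (by fun_prop)
          (fun s => hds s _) hp.1 hp'.1
        have o2 := osc1 (h := fun x => g (p'.1, x)) (h' := fun x => gt (p'.1, x)) (by fun_prop)
          (fun s => hdt _ s) hp.2 hp'.2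
        have tri : ‖g p - g p'‖ ≤ ‖g (p.1, p.2) - g (p'.1, p.2)‖ + ‖g (p'.1, p.2) - g (p'.1, p'.2)‖ :=
          norm_sub_le_norm_sub_add_norm_sub _ _ _
        have : ‖g p - g p'‖ ^ 2 ≤ (‖g (p.1, p.2) - g (p'.1, p.2)‖ + ‖g (p'.1, p.2) - g (p'.1, p'.2)‖) ^ 2 := by
          gcongr
        nlinarith [sq_nonneg (‖g (p.1, p.2) - g (p'.1, p.2)‖ - ‖g (p'.1, p.2) - g (p'.1, p'.2)‖)]
    refine this.trans (le_of_eq ?_)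
    rw [integral_add (USq_int (a1.const_mul 2)) (USq_int continuous_const),
      USq_const, integral_const_mul, b1]
  have hfin := setIntegral_mono_on (USq_int (by fun_prop)) (USq_int (by
    exact continuous_const.add (a2.const_mul 2))) hms hstep
  rw [integral_add (USq_int (by fun_prop)) (USq_int (by fun_prop)), USq_const,
    integral_add (USq_int (by fun_prop)) (USq_int (a2.const_mul 2)), USq_const, 
    integral_const_mul, b2] at hfin
  rw [integral_add (USq_int c1) (USq_int c2)]
  linarith

def latMap (τ : ℂ) : ℝ × ℝ → ℂ := fun p => (p.1 : ℂ) + (p.2 : ℂ) * τ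

lemma latMap_cont (τ : ℂ) : Continuous (latMap τ) := by unfold latMap; fun_prop

def latLin (τ : ℂ) : ℝ × ℝ →ₗ[ℝ] ℂ where
  toFun := latMap τ
  map_add' p q := by simp only [latMap, Prod.fst_add, Prod.snd_add]; push_cast; ring
  map_smul' r p := by
    simp only [latMap, Prod.smul_fst, Prod.smul_snd, smul_eq_mul, RingHom.id_apply, Complex.real_smul]
    push_cast; ring

lemma latMap_inj {τ : ℂ} (hτ : 0 < τ.im) : Function.Injective (latMap τ) := by
  intro p q h
  have h2 : p.2 = q.2 := by
    have := congrArg Complex.im h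
    simp [latMap] at this
    rcases this with h | h
    · exact h
    · exact absurd h hτ.ne'
  have h1 : p.1 = q.1 := by
    have := congrArg Complex.re h
    simp [latMap, h2] at this
    exact this
  exact Prod.ext h1 h2

lemma lat_cov {τ : ℂ} (hτ : 0 < τ.im) : ∃ c : ℝ, 0 < c ∧
    ∀ (E : Type) [NormedAddCommGroup E] [NormedSpace ℝ E] (f : ℂ → E),
      ∫ z in latMap τ '' USq, f z = c • ∫ p in USq, f (latMap τ p) := by
  let e : (ℝ × ℝ) ≃L[ℝ] ℂ := (LinearEquiv.ofInjectiveOfFinrankEq (latLin τ) (latMap_inj hτ)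
    (by simp)).toContinuousLinearEquiv
  have he : ∀ p, e p = latMap τ p := fun p => rfl
  have hemb : MeasurableEmbedding (latMap τ) := e.toHomeomorph.measurableEmbedding
  have : (Measure.map e (volume : Measure (ℝ × ℝ))).IsAddHaarMeasure := e.isAddHaarMeasure_map _
  obtain ⟨c, hc0, hct, hc⟩ : ∃ c : ENNReal, c ≠ 0 ∧ c ≠ ⊤ ∧ (volume : Measure ℂ) =
      c • Measure.map (latMap τ) (volume : Measure (ℝ × ℝ)) := by
    refine ⟨_, ?_, ?_, Measure.isAddLeftInvariant_eq_smul (volume : Measure ℂ) (Measure.map e (volume : Measure (ℝ × ℝ)))⟩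
    · exact_mod_cast (Measure.addHaarScalarFactor_pos_of_isAddHaarMeasure _ _).ne'
    · exact ENNReal.coe_ne_top
  refine ⟨c.toReal, ENNReal.toReal_pos hc0 hct, ?_⟩
  intro E _ _ f
  rw [hc, Measure.restrict_smul, integral_smul_measure, hemb.setIntegral_map,
    (latMap_inj hτ).preimage_image]

lemma lat_entry {τ : ℂ} (hτ : 0 < τ.im) {f : ℂ → ℂ} (hf : ContDiff ℝ (⊤ : ℕ∞) f)
    (h1 : ∀ z, f (z + 1) = f z) (h2 : ∀ z, f (z + τ) = f z) (a b κ : ℝ)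
    (hκ : κ ≤ ‖Complex.exp (a * Complex.I) - 1‖ ^ 2 +
        ‖Complex.exp (((τ.re * a + τ.im * b : ℝ) : ℂ) * Complex.I) - 1‖ ^ 2 ∨
      (κ ≤ 1 ∧ a = 0 ∧ b = 0 ∧ ∫ z in latMap τ '' USq, f z = 0)) :
    κ * ∫ z in latMap τ '' USq, ‖f z‖ ^ 2 ≤ (1 + ‖τ‖ ^ 2) *
      ∫ z in latMap τ '' USq, (‖fderiv ℝ f z 1 + a * Complex.I * f z‖ ^ 2 +
        ‖fderiv ℝ f z Complex.I + b * Complex.I * f z‖ ^ 2) := by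
  obtain ⟨c, hc, hcov⟩ := lat_cov hτ
  have hL := latMap_cont τ
  have hfc : Continuous f := hf.continuous
  have hd : ∀ v, Continuous fun z => fderiv ℝ f z v := fun v =>
    (hf.continuous_fderiv (by simp)).clm_apply continuous_const
  have hd1 := hd 1
  have hdI := hd Complex.I
  have hdτ := hd τ
  have hτ' : ∀ z, fderiv ℝ f z τ = τ.re * fderiv ℝ f z 1 + τ.im * fderiv ℝ f z Complex.I := by
    intro z
    have : τ = τ.re • (1 : ℂ) + τ.im • Complex.I := by
      simp [Complex.re_add_im]
    conv_lhs => rw [this]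
    rw [map_add, map_smul, map_smul]; simp
  have hfd : ∀ z, HasFDerivAt f (fderiv ℝ f z) z := fun z =>
    (hf.differentiable (by simp) z).hasFDerivAt
  set g : ℝ × ℝ → ℂ := fun p => f (latMap τ p) with hgdef
  set gs : ℝ × ℝ → ℂ := fun p => fderiv ℝ f (latMap τ p) 1
  set gt : ℝ × ℝ → ℂ := fun p => fderiv ℝ f (latMap τ p) τ
  have cg : Continuous g := by fun_prop
  have cgs : Continuous gs := hd1.comp hL
  have cgt : Continuous gt := hdτ.comp hL
  have hds : ∀ s t, HasDerivAt (fun x => g (x, t)) (gs (s, t)) s := by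
    intro s t
    have hl : HasDerivAt (fun x : ℝ => latMap τ (x, t)) 1 s := by
      simpa [latMap] using (Complex.ofRealCLM.hasDerivAt (x := s)).add_const ((t : ℂ) * τ)
    exact (hfd (latMap τ (s, t))).comp_hasDerivAt s hl
  have hdt : ∀ s t, HasDerivAt (fun x => g (s, x)) (gt (s, t)) t := by
    intro s t
    have hl : HasDerivAt (fun x : ℝ => latMap τ (s, x)) τ t := by
      simpa [latMap] using ((Complex.ofRealCLM.hasDerivAt (x := t)).mul_const τ).const_add (s : ℂ)
    exact (hfd (latMap τ (s, t))).comp_hasDerivAt t hl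
  have hps : ∀ s t, g (s + 1, t) = g (s, t) := by
    intro s t
    simp only [hgdef]; rw [← h1 (latMap τ (s, t))]
    congr 1; simp only [latMap]; push_cast; ring
  have hpt : ∀ s t, g (s, t + 1) = g (s, t) := by
    intro s t
    simp only [hgdef]; rw [← h2 (latMap τ (s, t))]
    congr 1; simp only [latMap]; push_cast; ring
  have hnn : 0 ≤ ∫ p in USq, ‖g p‖ ^ 2 := integral_nonneg fun _ => by positivity
  have key : κ * ∫ p in USq, ‖g p‖ ^ 2 ≤ ∫ p in USq, (‖gs p + a * Complex.I * g p‖ ^ 2 +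
      ‖gt p + ((τ.re * a + τ.im * b : ℝ) : ℂ) * Complex.I * g p‖ ^ 2) := by
    rcases hκ with hκ | ⟨hκ, rfl, rfl, h0⟩
    · exact (mul_le_mul_of_nonneg_right hκ hnn).trans
        (twisted2 cg cgs cgt hds hdt hps hpt a (τ.re * a + τ.im * b))
    · rw [hcov] at h0
      have h0' : ∫ p in USq, g p = 0 := (smul_eq_zero.1 h0).resolve_left hc.ne'
      have := meanzero2 cg cgs cgt hds hdt h0'
      simp only [mul_zero, add_zero, Complex.ofReal_zero, zero_mul]
      exact (mul_le_mul_of_nonneg_right hκ hnn).trans (by rwa [one_mul])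
  have key2 : ∫ p in USq, (‖gs p + a * Complex.I * g p‖ ^ 2 +
      ‖gt p + ((τ.re * a + τ.im * b : ℝ) : ℂ) * Complex.I * g p‖ ^ 2) ≤
      (1 + ‖τ‖ ^ 2) * ∫ p in USq, (‖fderiv ℝ f (latMap τ p) 1 + a * Complex.I * f (latMap τ p)‖ ^ 2 +
        ‖fderiv ℝ f (latMap τ p) Complex.I + b * Complex.I * f (latMap τ p)‖ ^ 2) := by
    rw [← integral_const_mul]
    have cI : Continuous fun p => fderiv ℝ f (latMap τ p) Complex.I := hdI.comp hL
    have c1 : Continuous fun p => fderiv ℝ f (latMap τ p) 1 := hd1.comp hL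
    refine integral_mono (USq_int (by fun_prop)) (USq_int (by fun_prop)) fun p => ?_
    set A := fderiv ℝ f (latMap τ p) 1 + a * Complex.I * f (latMap τ p) with hA
    set B := fderiv ℝ f (latMap τ p) Complex.I + b * Complex.I * f (latMap τ p) with hB
    have e2 : gt p + ((τ.re * a + τ.im * b : ℝ) : ℂ) * Complex.I * g p = τ.re * A + τ.im * B := by
      simp only [gt, hgdef, hτ', hA, hB]; push_cast; ring
    simp only []
    rw [e2]
    have n1 : ‖(τ.re : ℂ) * A + τ.im * B‖ ≤ |τ.re| * ‖A‖ + |τ.im| * ‖B‖ := by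
      refine (norm_add_le _ _).trans (le_of_eq ?_)
      simp
    have n2 : ‖(τ.re : ℂ) * A + τ.im * B‖ ^ 2 ≤ (|τ.re| * ‖A‖ + |τ.im| * ‖B‖) ^ 2 := by gcongr
    have n3 : ‖τ‖ ^ 2 = |τ.re| ^ 2 + |τ.im| ^ 2 := by
      rw [Complex.sq_norm, Complex.normSq_apply, sq_abs, sq_abs]; ring
    rw [n3]
    nlinarith [sq_nonneg (|τ.re| * ‖B‖ - |τ.im| * ‖A‖), sq_nonneg ‖B‖]
  rw [hcov, hcov, smul_eq_mul, smul_eq_mul]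
  calc _ = c * (κ * ∫ p in USq, ‖g p‖ ^ 2) := by simp only [hgdef]; ring
    _ ≤ c * _ := mul_le_mul_of_nonneg_left (key.trans key2) hc.le
    _ = _ := by ring

lemma kappa_pos {τ q : ℂ} (hτ : 0 < τ.im) (hq : ∀ m l : ℤ, q ≠ (m : ℂ) + (l : ℂ) * τ) (a b : ℝ)
    (ha : a = 2 * Real.pi * q.im / τ.im) (hb : b = -(2 * Real.pi * q.re / τ.im)) :
    0 < ‖Complex.exp (a * Complex.I) - 1‖ ^ 2 +
        ‖Complex.exp (((τ.re * a + τ.im * b : ℝ) : ℂ) * Complex.I) - 1‖ ^ 2 := by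
  have aux : ∀ x : ℝ, Complex.exp (x * Complex.I) = 1 → ∃ n : ℤ, x = n * (2 * Real.pi) := by
    intro x hx
    obtain ⟨n, hn⟩ := Complex.exp_eq_one_iff.1 hx
    refine ⟨n, ?_⟩
    have := congrArg Complex.im hn
    simpa using this
  by_contra hcon
  have z1 : ‖Complex.exp (a * Complex.I) - 1‖ ^ 2 = 0 := by
    nlinarith [sq_nonneg ‖Complex.exp (a * Complex.I) - 1‖, sq_nonneg ‖Complex.exp (((τ.re * a + τ.im * b : ℝ) : ℂ) * Complex.I) - 1‖]
  have z2 : ‖Complex.exp (((τ.re * a + τ.im * b : ℝ) : ℂ) * Complex.I) - 1‖ ^ 2 = 0 := by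
    nlinarith [sq_nonneg ‖Complex.exp (a * Complex.I) - 1‖, sq_nonneg ‖Complex.exp (((τ.re * a + τ.im * b : ℝ) : ℂ) * Complex.I) - 1‖]
  obtain ⟨m, hm⟩ := aux _ (sub_eq_zero.1 (norm_eq_zero.1 (pow_eq_zero_iff two_ne_zero |>.1 z1)))
  obtain ⟨l, hl⟩ := aux _ (sub_eq_zero.1 (norm_eq_zero.1 (pow_eq_zero_iff two_ne_zero |>.1 z2)))
  have hpi := Real.pi_pos.ne'
  have him : q.im = m * τ.im := by
    rw [ha] at hm; field_simp at hm; linarith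
  have hre : q.re = -l + m * τ.re := by
    have : τ.im * b = -(2 * Real.pi * q.re) := by rw [hb]; field_simp
    rw [this, hm] at hl
    have : (2 * Real.pi) * (τ.re * m - q.re - l) = 0 := by linarith
    have := (mul_eq_zero.1 this).resolve_left (by positivity)
    linarith
  apply hq (-l) m
  apply Complex.ext
  · simp [hre]
  · simp [him]

lemma kappa_unif {K : Type*} [TopologicalSpace K] [CompactSpace K] {φ : K → ℝ} (hφ : Continuous φ)
    (h : ∀ k, 0 < φ k) : ∃ c : ℝ, 0 < c ∧ ∀ k, c ≤ φ k := by
  obtain ⟨c, hc, h⟩ := isCompact_univ.exists_forall_le' hφ.continuousOn (fun k _ => h k)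
  exact ⟨c, hc, fun k => h k trivial⟩

/-- Uniform Poincaré inequality (Lemma 5.2 of the paper): over a compact family
`k ∈ K` of elliptic curves `ℂ/(ℤ + τ(k)ℤ)` with flat diagonal connections
determined by pairwise-distinct points `q₁(k), …, qₙ(k)` modulo the lattice,
there is a uniform constant `C > 0` such that any doubly periodic smooth
matrix-valued `η` that is `L²`-orthogonal on the fundamental domain `F_k` to the
constant diagonal matrices satisfies
`∫_{F_k} (‖∂_x η + [P_x, η]‖² + ‖∂_y η + [P_y, η]‖²) ≥ C ∫_{F_k} ‖η‖²`,
with `‖·‖` the Frobenius norm (written out entrywise). -/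
theorem uniform_first_eigenvalue_lower_bound
    (n : ℕ) (hn : 1 ≤ n) (K : Type*) [TopologicalSpace K] [CompactSpace K]
    (τ : K → ℂ) (hτc : Continuous τ) (hτ : ∀ k, 0 < (τ k).im)
    (q : Fin n → K → ℂ) (hqc : ∀ i, Continuous (q i))
    (hq : ∀ (k : K) (i j : Fin n), i ≠ j →
      ∀ m l : ℤ, q i k - q j k ≠ (m : ℂ) + (l : ℂ) * τ k) :
    ∃ C : ℝ, 0 < C ∧
      ∀ k : K,
        let Q : Matrix (Fin n) (Fin n) ℂ := Matrix.diagonal (fun i => q i k)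
        let Px : Matrix (Fin n) (Fin n) ℂ :=
          ((Real.pi : ℂ) * (((τ k).im : ℂ))⁻¹) • (Q - Qᴴ)
        let Py : Matrix (Fin n) (Fin n) ℂ :=
          (-Complex.I * (Real.pi : ℂ) * (((τ k).im : ℂ))⁻¹) • (Q + Qᴴ)
        let F : Set ℂ :=
          (fun p : ℝ × ℝ => (p.1 : ℂ) + (p.2 : ℂ) * τ k) ''
            (Set.Icc (0 : ℝ) 1 ×ˢ Set.Icc (0 : ℝ) 1)
        ∀ η : ℂ → Matrix (Fin n) (Fin n) ℂ,
          (∀ i j, ContDiff ℝ (⊤ : ℕ∞) (fun z => η z i j)) →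
          (∀ z, η (z + 1) = η z) →
          (∀ z, η (z + τ k) = η z) →
          (∀ d : Fin n → ℂ,
            (∫ z in F, Matrix.trace (η z * (Matrix.diagonal d)ᴴ)) = 0) →
          C * ∫ z in F, ∑ i, ∑ j, ‖η z i j‖ ^ 2 ≤
            ∫ z in F,
              ((∑ i, ∑ j,
                ‖(Matrix.of fun i j => fderiv ℝ (fun w => η w i j) z 1) i j +
                  (Px * η z - η z * Px) i j‖ ^ 2) +
               (∑ i, ∑ j,
                ‖(Matrix.of fun i j => fderiv ℝ (fun w => η w i j) z Complex.I) i j +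
                  (Py * η z - η z * Py) i j‖ ^ 2)) := by
  let a : Fin n → Fin n → K → ℝ := fun i j k =>
    2 * Real.pi * (q i k - q j k).im / (τ k).im
  let b : Fin n → Fin n → K → ℝ := fun i j k =>
    -(2 * Real.pi * (q i k - q j k).re / (τ k).im)
  let φ : Fin n → Fin n → K → ℝ := fun i j k =>
    ‖Complex.exp (a i j k * Complex.I) - 1‖ ^ 2 +
      ‖Complex.exp ((((τ k).re * a i j k + (τ k).im * b i j k : ℝ) : ℂ) * Complex.I) - 1‖ ^ 2
  have hreτ : Continuous fun k => (τ k).re := Complex.continuous_re.comp hτc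
  have himτ : Continuous fun k => (τ k).im := Complex.continuous_im.comp hτc
  have hac : ∀ i j, Continuous (a i j) := fun i j =>
    (continuous_const.mul (Complex.continuous_im.comp ((hqc i).sub (hqc j)))).div himτ
      fun k => (hτ k).ne'
  have hbc : ∀ i j, Continuous (b i j) := fun i j =>
    ((continuous_const.mul (Complex.continuous_re.comp ((hqc i).sub (hqc j)))).div himτ
      fun k => (hτ k).ne').neg
  have hφc : ∀ i j, Continuous (φ i j) := by
    intro i j
    have h1 := hac i j
    have h2 := hbc i j
    simp only [φ]
    fun_prop
  have hex : ∀ ij : Fin n × Fin n, ∃ c : ℝ, 0 < c ∧ (ij.1 ≠ ij.2 → ∀ k, c ≤ φ ij.1 ij.2 k) := by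
    rintro ⟨i, j⟩
    by_cases hij : i = j
    · exact ⟨1, one_pos, fun h => absurd hij h⟩
    · obtain ⟨c, hc, h⟩ := kappa_unif (hφc i j)
        (fun k => kappa_pos (hτ k) (hq k i j hij) (a i j k) (b i j k) rfl rfl)
      exact ⟨c, hc, fun _ => h⟩
  choose c hc hcφ using hex
  obtain ⟨c₀, hc₀, hc₀1, hc₀c⟩ : ∃ c₀ : ℝ, 0 < c₀ ∧ c₀ ≤ 1 ∧ ∀ ij, c₀ ≤ c ij := by
    obtain ⟨d, hd, h⟩ := (Set.finite_univ (α := Fin n × Fin n)).isCompact.exists_forall_le'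
      (f := c) (a := 0) continuous_of_discreteTopology.continuousOn (fun ij _ => hc ij)
    exact ⟨min d 1, lt_min hd one_pos, min_le_right _ _,
      fun ij => (min_le_left _ _).trans (h ij trivial)⟩
  obtain ⟨N, hN, hNτ⟩ := kappa_unif (K := K) (φ := fun k => (1 + ‖τ k‖ ^ 2)⁻¹)
    (Continuous.inv₀ (by fun_prop) fun k => by positivity) (fun k => by positivity)
  refine ⟨c₀ * N, by positivity, ?_⟩
  intro k Q Px Py F η hη h1 h2 horth
  have hF : F = latMap (τ k) '' USq := rfl
  have hFc : IsCompact F := by rw [hF]; exact USq_compact.image (latMap_cont _)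
  have hPx : Px = Matrix.diagonal fun i =>
      ((2 * Real.pi * (q i k).im / (τ k).im : ℝ) : ℂ) * Complex.I := by
    simp only [Px, Q, Matrix.diagonal_conjTranspose, Matrix.diagonal_sub, ← Matrix.diagonal_smul]
    congr 1; funext i
    simp only [Pi.smul_apply, Pi.star_apply, smul_eq_mul, RCLike.star_def, Complex.sub_conj]
    push_cast; ring
  have hPy : Py = Matrix.diagonal fun i =>
      ((-(2 * Real.pi * (q i k).re / (τ k).im) : ℝ) : ℂ) * Complex.I := by
    simp only [Py, Q, Matrix.diagonal_conjTranspose, Matrix.diagonal_add, ← Matrix.diagonal_smul]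
    congr 1; funext i
    simp only [Pi.smul_apply, Pi.star_apply, smul_eq_mul, RCLike.star_def, Complex.add_conj]
    push_cast; ring
  have hX : ∀ z i j, (Px * η z - η z * Px) i j = a i j k * Complex.I * η z i j := by
    intro z i j
    rw [hPx, Matrix.sub_apply, Matrix.diagonal_mul, Matrix.mul_diagonal]
    simp only [a, Complex.sub_im]; push_cast; ring
  have hY : ∀ z i j, (Py * η z - η z * Py) i j = b i j k * Complex.I * η z i j := by
    intro z i j
    rw [hPy, Matrix.sub_apply, Matrix.diagonal_mul, Matrix.mul_diagonal]
    simp only [b, Complex.sub_re]; push_cast; ring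
  simp only [hX, hY, Matrix.of_apply, ← Finset.sum_add_distrib]
  have hηc : ∀ i j, Continuous fun z => η z i j := fun i j => (hη i j).continuous
  have hd : ∀ i j v, Continuous fun z => fderiv ℝ (fun w => η w i j) z v := fun i j v =>
    ((hη i j).continuous_fderiv (by simp)).clm_apply continuous_const
  have hint1 : ∀ i j, IntegrableOn (fun z => ‖η z i j‖ ^ 2) F := fun i j => by
    have := hηc i j
    exact (Continuous.continuousOn (by fun_prop)).integrableOn_compact hFc
  have hint2 : ∀ i j, IntegrableOn (fun z =>
      ‖fderiv ℝ (fun w => η w i j) z 1 + a i j k * Complex.I * η z i j‖ ^ 2 +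
      ‖fderiv ℝ (fun w => η w i j) z Complex.I + b i j k * Complex.I * η z i j‖ ^ 2) F :=
    fun i j => by
      have := hηc i j
      have := hd i j 1
      have := hd i j Complex.I
      exact (Continuous.continuousOn (by fun_prop)).integrableOn_compact hFc
  rw [integral_finsetSum _ fun i _ => integrable_finsetSum _ fun j _ => hint1 i j,
    integral_finsetSum _ fun i _ => integrable_finsetSum _ fun j _ => hint2 i j, Finset.mul_sum]
  refine Finset.sum_le_sum fun i _ => ?_
  rw [integral_finsetSum _ fun j _ => hint1 i j, integral_finsetSum _ fun j _ => hint2 i j,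
    Finset.mul_sum]
  refine Finset.sum_le_sum fun j _ => ?_
  have hen := lat_entry (hτ k) (hη i j) (fun z => by rw [h1]) (fun z => by rw [h2])
    (a i j k) (b i j k) c₀ (by
      by_cases hij : i = j
      · subst hij
        refine Or.inr ⟨hc₀1, by simp [a], by simp [b], ?_⟩
        have := horth (Pi.single i 1)
        rw [hF] at this
        rw [← this]
        congr 1; funext z
        rw [Matrix.diagonal_conjTranspose, Matrix.trace]
        simp only [Matrix.diag_apply, Matrix.mul_diagonal, Pi.star_apply]
        rw [Finset.sum_eq_single i]
        · simp
        · intro j _ hj; simp [Pi.single_eq_of_ne hj]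
        · simp
      · exact Or.inl ((hc₀c (i, j)).trans (hcφ (i, j) hij k)))
  rw [← hF] at hen
  set I1 := ∫ z in F, ‖η z i j‖ ^ 2
  have hM : 0 < 1 + ‖τ k‖ ^ 2 := by positivity
  have hI1 : 0 ≤ I1 := integral_nonneg fun _ => by positivity
  calc c₀ * N * I1 = N * (c₀ * I1) := by ring
    _ ≤ (1 + ‖τ k‖ ^ 2)⁻¹ * (c₀ * I1) :=
      mul_le_mul_of_nonneg_right (hNτ k) (by positivity)
    _ ≤ _ := by
      rw [inv_mul_le_iff₀ hM]; exact hen
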